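/- arXiv:1509.06009 — 2 statements merged into one kernel-verified Lean document; each statement's English description precedes it below -/
import Mathlib

section
/- Any two distinct Fano planes on {1,2,3,4,5,6,7} have exactly 0, 1, or 3 lines in common. -/
/-- The point set {1,...,7}. -/
def pts : Finset ℕ := Finset.Icc 1 7

/-- All three-element subsets of {1,...,7}, the candidate lines. -/
def lines : Finset (Finset ℕ) := pts.powersetCard 3

/-- A line {a,b,c} with a < b < c is ordinary if a + b = c. -/
def Ordinary (l : Finset ℕ) : Prop :=
  ∃ a ∈ l, ∃ b ∈ l, ∃ c ∈ l, a < b ∧ b < c ∧ a + b = c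

instance : DecidablePred Ordinary := fun l => by unfold Ordinary; infer_instance

/-- A line is defective if it is not ordinary. -/
def Defective (l : Finset ℕ) : Prop := ¬ Ordinary l

instance : DecidablePred Defective := fun l => by unfold Defective; infer_instance

/-- A Fano plane on {1,...,7}: seven 3-element subsets such that every pair of
distinct points lies on exactly one line. -/
def IsFano (F : Finset (Finset ℕ)) : Prop :=
  F ⊆ lines ∧ F.card = 7 ∧
    ∀ p ∈ pts, ∀ q ∈ pts, p ≠ q →
      (F.filter (fun l => p ∈ l ∧ q ∈ l)).card = 1

instance : DecidablePred IsFano := fun F => by unfold IsFano; infer_instance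

/-- The collection of all Fano planes on {1,...,7}. -/
def fanos : Finset (Finset (Finset ℕ)) := (lines.powersetCard 7).filter IsFano

/-- The order of a point p in a plane F: the number of defective lines of F through p. -/
def order (F : Finset (Finset ℕ)) (p : ℕ) : ℕ :=
  (F.filter (fun l => Defective l ∧ p ∈ l)).card

/-- The number of points of order s in the plane F. -/
def nOrd (F : Finset (Finset ℕ)) (s : ℕ) : ℕ :=
  (pts.filter (fun p => order F p = s)).card

namespace IsFano

variable {F : Finset (Finset ℕ)} {l m : Finset ℕ}

theorem subset_pts (hF : IsFano F) (hl : l ∈ F) : l ⊆ pts :=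
  (Finset.mem_powersetCard.1 (hF.1 hl)).1

theorem card_line (hF : IsFano F) (hl : l ∈ F) : l.card = 3 :=
  (Finset.mem_powersetCard.1 (hF.1 hl)).2

theorem exists_line (hF : IsFano F) {p q : ℕ} (hp : p ∈ pts) (hq : q ∈ pts) (hpq : p ≠ q) :
    ∃ n ∈ F, p ∈ n ∧ q ∈ n := by
  obtain ⟨n, hn⟩ := Finset.card_eq_one.1 (hF.2.2 p hp q hq hpq)
  exact ⟨n, Finset.mem_filter.1 (hn ▸ Finset.mem_singleton_self n)⟩

theorem line_unique (hF : IsFano F) (hl : l ∈ F) (hm : m ∈ F) {p q : ℕ} (hpq : p ≠ q)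
    (hpl : p ∈ l) (hql : q ∈ l) (hpm : p ∈ m) (hqm : q ∈ m) : l = m := by
  have h := hF.2.2 p (hF.subset_pts hl hpl) q (hF.subset_pts hl hql) hpq
  exact Finset.card_le_one.1 h.le l (by simp [*]) m (by simp [*])

theorem inter_nonempty (hF : IsFano F) (hl : l ∈ F) (hm : m ∈ F) : (l ∩ m).Nonempty := by
  by_contra h
  have hdisj : Disjoint l m :=
    Finset.disjoint_iff_inter_eq_empty.2 (Finset.not_nonempty_iff_eq_empty.1 h)
  have hrest : (pts \ (l ∪ m)).card = 1 := by
    rw [Finset.card_sdiff_of_subset (Finset.union_subset (hF.subset_pts hl) (hF.subset_pts hm)),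
      Finset.card_union_of_disjoint hdisj, hF.card_line hl, hF.card_line hm]
    rfl
  obtain ⟨z, hz⟩ := Finset.card_eq_one.1 hrest
  obtain ⟨x, hx⟩ : l.Nonempty := Finset.card_pos.1 (by rw [hF.card_line hl]; norm_num)
  obtain ⟨y₁, hy₁, y₂, hy₂, hy⟩ := Finset.one_lt_card.1 (by rw [hF.card_line hm]; norm_num :
    1 < m.card)
  have hzl : z ∉ l ∪ m := (Finset.mem_sdiff.1 (hz ▸ Finset.mem_singleton_self z)).2
  have hxm : x ∉ m := Finset.disjoint_left.1 hdisj hx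
  -- The line joining `x` to a point of `m` must pass through the seventh point `z`.
  have key : ∀ y ∈ m, ∃ n ∈ F, x ∈ n ∧ y ∈ n ∧ z ∈ n := by
    intro y hym
    have hyl : y ∉ l := Finset.disjoint_right.1 hdisj hym
    have hxy : x ≠ y := fun h => hxm (h ▸ hym)
    obtain ⟨n, hn, hxn, hyn⟩ :=
      hF.exists_line (hF.subset_pts hl hx) (hF.subset_pts hm hym) hxy
    obtain ⟨w, hwn, hw⟩ := Finset.exists_mem_notMem_of_card_lt_card
      (by rw [hF.card_line hn, Finset.card_pair hxy]; norm_num : ({x, y} : Finset ℕ).card < n.card)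
    simp only [Finset.mem_insert, Finset.mem_singleton, not_or] at hw
    have hwl : w ∉ l := fun h => hyl (hF.line_unique hn hl hw.1 hwn hxn h hx ▸ hyn)
    have hwm : w ∉ m := fun h => hxm (hF.line_unique hn hm hw.2 hwn hyn h hym ▸ hxn)
    have hwz : w ∈ pts \ (l ∪ m) := by simp [hwl, hwm, hF.subset_pts hn hwn]
    rw [hz, Finset.mem_singleton] at hwz
    exact ⟨n, hn, hxn, hyn, hwz ▸ hwn⟩
  obtain ⟨n₁, hn₁, hxn₁, hyn₁, hzn₁⟩ := key y₁ hy₁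
  obtain ⟨n₂, hn₂, hxn₂, hyn₂, hzn₂⟩ := key y₂ hy₂
  have hxz : x ≠ z := fun h => hzl (Finset.mem_union_left _ (h ▸ hx))
  have hn : n₁ = n₂ := hF.line_unique hn₁ hn₂ hxz hxn₁ hzn₁ hxn₂ hzn₂
  subst hn
  exact hxm (hF.line_unique hn₁ hm hy hyn₁ hyn₂ hy₁ hy₂ ▸ hxn₁)

/-- The third line through the common point of two lines of a Fano plane is the complement of
their symmetric difference. -/
theorem sdiff_symmDiff_mem (hF : IsFano F) (hl : l ∈ F) (hm : m ∈ F) (hlm : l ≠ m) :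
    pts \ symmDiff l m ∈ F := by
  obtain ⟨p, hp⟩ := hF.inter_nonempty hl hm
  have hpl := (Finset.mem_inter.1 hp).1
  have hpm := (Finset.mem_inter.1 hp).2
  have hinter : (l ∩ m).card = 1 := Finset.card_eq_one.2 ⟨p, Finset.eq_singleton_iff_unique_mem.2
    ⟨hp, fun q hq => by
      by_contra hqp
      exact hlm (hF.line_unique hl hm hqp (Finset.mem_inter.1 hq).1 hpl
        (Finset.mem_inter.1 hq).2 hpm)⟩⟩
  have hunion : (l ∪ m).card = 5 := by
    have h := Finset.card_union_add_card_inter l m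
    rw [hinter, hF.card_line hl, hF.card_line hm] at h
    omega
  have hsub := Finset.union_subset (hF.subset_pts hl) (hF.subset_pts hm)
  have hpts : pts.card = 7 := rfl
  obtain ⟨q, hq, hqlm⟩ := Finset.exists_mem_notMem_of_card_lt_card
    (by rw [hunion, hpts]; norm_num : (l ∪ m).card < pts.card)
  simp only [Finset.mem_union, not_or] at hqlm
  have hpq : p ≠ q := fun h => hqlm.1 (h ▸ hpl)
  obtain ⟨n, hn, hpn, hqn⟩ := hF.exists_line (hF.subset_pts hl hpl) hq hpq
  have hsymm : symmDiff l m = (l ∪ m) \ (l ∩ m) := symmDiff_eq_sup_sdiff_inf l m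
  have hcard : (pts \ symmDiff l m).card = 3 := by
    rw [hsymm, Finset.card_sdiff_of_subset (Finset.sdiff_subset.trans hsub),
      Finset.card_sdiff_of_subset Finset.inter_subset_union, hunion, hinter, hpts]
  have hsubset : n ⊆ pts \ symmDiff l m := by
    intro r hr
    rw [Finset.mem_sdiff, Finset.mem_symmDiff]
    refine ⟨hF.subset_pts hn hr, ?_⟩
    by_cases hrp : r = p
    · subst hrp
      tauto
    · rintro (⟨h, -⟩ | ⟨h, -⟩)
      · exact hqlm.1 (hF.line_unique hn hl hrp hr hpn h hpl ▸ hqn)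
      · exact hqlm.2 (hF.line_unique hn hm hrp hr hpn h hpm ▸ hqn)
  rwa [← Finset.eq_of_subset_of_card_le hsubset (by rw [hcard, hF.card_line hn])]

theorem ne_pts (hF : IsFano F) (hl : l ∈ F) : l ≠ pts := by
  rintro rfl
  exact absurd (hF.card_line hl) (by decide)

end IsFano

theorem sdiff_symmDiff_cancel_left {α : Type*} [DecidableEq α] {A l m : Finset α} (hm : m ⊆ A) :
    A \ symmDiff l (A \ symmDiff l m) = m := by
  ext x
  have := @hm x
  simp only [Finset.mem_sdiff, Finset.mem_symmDiff]
  tauto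

/-- A family of proper subsets of `A` closed under complemented symmetric difference of distinct
members has `0`, `1`, `3` or at least `7` members. -/
theorem card_of_sdiff_symmDiff_closed {α : Type*} [DecidableEq α] {A : Finset α}
    {S : Finset (Finset α)} (hsub : ∀ l ∈ S, l ⊆ A) (hne : ∀ l ∈ S, l ≠ A)
    (hclosed : ∀ l ∈ S, ∀ m ∈ S, l ≠ m → A \ symmDiff l m ∈ S) :
    S.card = 0 ∨ S.card = 1 ∨ S.card = 3 ∨ 7 ≤ S.card := by
  by_cases hS : S.card ≤ 1
  · omega
  obtain ⟨l, hl, m, hm, hlm⟩ := Finset.one_lt_card.1 (not_le.1 hS)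
  set t : Finset α → Finset α → Finset α := fun x y => A \ symmDiff x y with ht
  have hcomm : ∀ x y, t x y = t y x := fun x y => by simp only [ht, symmDiff_comm]
  have hcancel : ∀ x, ∀ y ∈ S, t x (t x y) = y :=
    fun x y hy => sdiff_symmDiff_cancel_left (hsub y hy)
  have hself : ∀ x, t x x = A := fun x => by simp [ht]
  have hinj : ∀ x, ∀ y ∈ S, ∀ z ∈ S, t x y = t x z → y = z := fun x y hy z hz h => by
    rw [← hcancel x y hy, h, hcancel x z hz]
  have hleft : ∀ x ∈ S, ∀ y ∈ S, t x y ≠ x := fun x hx y hy h =>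
    hne y hy (by rw [← hcancel x y hy, h, hself])
  have hright : ∀ x ∈ S, ∀ y ∈ S, t x y ≠ y := fun x hx y hy h =>
    hleft y hy x hx (hcomm x y ▸ h)
  have hk := hclosed l hl m hm hlm
  change t l m ∈ S at hk
  have hthree : ({l, m, t l m} : Finset (Finset α)).card = 3 :=
    Finset.card_eq_three.2 ⟨_, _, _, hlm, (hleft l hl m hm).symm, (hright l hl m hm).symm, rfl⟩
  have hT : ({l, m, t l m} : Finset (Finset α)) ⊆ S := by
    simp [Finset.insert_subset_iff, hl, hm, hk]
  by_cases hcard : S.card ≤ 3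
  · have := Finset.card_le_card hT
    omega
  obtain ⟨n, hn, hnT⟩ := Finset.exists_mem_notMem_of_card_lt_card
    (by omega : ({l, m, t l m} : Finset (Finset α)).card < S.card)
  set T : Finset (Finset α) := {l, m, t l m} with hTdef
  have hTclosed : ∀ x ∈ T, ∀ y ∈ T, x ≠ y → t x y ∈ T := by
    have h₁ : t l (t l m) = m := hcancel l m hm
    have h₂ : t m (t l m) = l := by rw [hcomm l m, hcancel m l hl]
    intro x hx y hy hxy
    simp only [hTdef, Finset.mem_insert, Finset.mem_singleton] at hx hy ⊢
    rcases hx with rfl | rfl | rfl <;> rcases hy with rfl | rfl | rfl <;>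
      simp_all
  have hnot : ∀ x ∈ T, t n x ∉ insert n T := by
    intro x hx h
    rcases Finset.mem_insert.1 h with h | h
    · exact hleft n hn x (hT hx) h
    · by_cases hxt : x = t n x
      · exact hright n hn x (hT hx) hxt.symm
      · refine hnT ?_
        have := hTclosed x hx _ h hxt
        rwa [hcomm n x, hcancel x n hn] at this
  have himage : (T.image (t n)).card = 3 := by
    rw [Finset.card_image_of_injOn, hthree]
    exact fun y hy z hz h => hinj n y (hT hy) z (hT hz) h
  have hdisj : Disjoint (insert n T) (T.image (t n)) := by
    rw [Finset.disjoint_right]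
    intro y hy
    obtain ⟨x, hx, rfl⟩ := Finset.mem_image.1 hy
    exact hnot x hx
  have hunion : insert n T ∪ T.image (t n) ⊆ S := by
    refine Finset.union_subset (Finset.insert_subset hn hT) ?_
    intro y hy
    obtain ⟨x, hx, rfl⟩ := Finset.mem_image.1 hy
    exact hclosed n hn x (hT hx) fun h => hnT (h ▸ hx)
  have := Finset.card_le_card hunion
  rw [Finset.card_union_of_disjoint hdisj, Finset.card_insert_of_notMem hnT, himage, hthree] at this
  omega

theorem fano_intersection : ∀ F G : Finset (Finset ℕ), IsFano F → IsFano G → F ≠ G →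
    (F ∩ G).card = 0 ∨ (F ∩ G).card = 1 ∨ (F ∩ G).card = 3 := by
  intro F G hF hG hFG
  have h := card_of_sdiff_symmDiff_closed (A := pts) (S := F ∩ G)
    (fun l hl => hF.subset_pts (Finset.mem_inter.1 hl).1)
    (fun l hl => hF.ne_pts (Finset.mem_inter.1 hl).1)
    (fun l hl m hm hlm => by
      rw [Finset.mem_inter] at hl hm ⊢
      exact ⟨hF.sdiff_symmDiff_mem hl.1 hm.1 hlm, hG.sdiff_symmDiff_mem hl.2 hm.2 hlm⟩)
  have hlt : (F ∩ G).card < 7 := by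
    by_contra! hge
    have h₁ := Finset.eq_of_subset_of_card_le (Finset.inter_subset_left : F ∩ G ⊆ F)
      (hF.2.1.trans_le hge)
    have h₂ := Finset.eq_of_subset_of_card_le (Finset.inter_subset_right : F ∩ G ⊆ G)
      (hG.2.1.trans_le hge)
    exact hFG (h₁.symm.trans h₂)
  omega
end

section
/- There are exactly 6 Fano planes on {1,2,3,4,5,6,7} all of whose lines are defective. -/
theorem IsFano.card_inter_le_one {F : Finset (Finset ℕ)} (hF : IsFano F) {l m : Finset ℕ}
    (hl : l ∈ F) (hm : m ∈ F) (hlm : l ≠ m) : (l ∩ m).card ≤ 1 := by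
  by_contra! h
  obtain ⟨p, hp, q, hq, hpq⟩ := Finset.one_lt_card.mp h
  rw [Finset.mem_inter] at hp hq
  have hsub : l ⊆ pts := (Finset.mem_powersetCard.mp (hF.1 hl)).1
  obtain ⟨k, hk⟩ := Finset.card_eq_one.mp (hF.2.2 p (hsub hp.1) q (hsub hq.1) hpq)
  have eq_k : ∀ n ∈ F, p ∈ n → q ∈ n → n = k := fun n hn hpn hqn =>
    Finset.mem_singleton.mp (hk ▸ Finset.mem_filter.mpr ⟨hn, hpn, hqn⟩)
  exact hlm ((eq_k l hl hp.1 hq.1).trans (eq_k m hm hp.2 hq.2).symm)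

/-- The defective candidate lines. -/
def defectiveLines : Finset (Finset ℕ) := lines.filter Defective

/-- All partial planes obtained from `A` by running through a list of pairs of points and joining
each pair not yet on a common line by a defective line that meets every earlier line in at most one
point. -/
def completions : List (ℕ × ℕ) → Finset (Finset ℕ) → Finset (Finset (Finset ℕ))
  | [], A => {A}
  | (p, q) :: ps, A =>
    if ∃ l ∈ A, p ∈ l ∧ q ∈ l then completions ps A
    else (defectiveLines.filter
      (fun l => (p ∈ l ∧ q ∈ l) ∧ ∀ m ∈ A, (l ∩ m).card ≤ 1)).biUnion
        (fun l => completions ps (insert l A))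

theorem IsFano.exists_completion_subset {F : Finset (Finset ℕ)} (hF : IsFano F)
    (hdef : ∀ l ∈ F, Defective l) (ps : List (ℕ × ℕ))
    (hps : ∀ x ∈ ps, x.1 ∈ pts ∧ x.2 ∈ pts ∧ x.1 ≠ x.2) (A : Finset (Finset ℕ)) (hA : A ⊆ F) :
    ∃ B ∈ completions ps A, B ⊆ F := by
  induction ps generalizing A with
  | nil => exact ⟨A, by simp [completions], hA⟩
  | cons x ps ih =>
    obtain ⟨p, q⟩ := x
    obtain ⟨⟨hp, hq, hpq⟩, hps⟩ := List.forall_mem_cons.mp hps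
    rw [completions]
    split_ifs with h
    · exact ih hps A hA
    · obtain ⟨l, hl⟩ := Finset.card_pos.mp (hF.2.2 p hp q hq hpq ▸ Nat.one_pos)
      obtain ⟨hlF, hpl, hql⟩ := Finset.mem_filter.mp hl
      obtain ⟨B, hB, hBF⟩ := ih hps (insert l A) (Finset.insert_subset hlF hA)
      refine ⟨B, Finset.mem_biUnion.mpr ⟨l, Finset.mem_filter.mpr
        ⟨Finset.mem_filter.mpr ⟨hF.1 hlF, hdef l hlF⟩, ⟨hpl, hql⟩, fun m hm => ?_⟩, hB⟩, hBF⟩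
      refine hF.card_inter_le_one hlF (hA hm) ?_
      rintro rfl
      exact h ⟨l, hm, hpl, hql⟩

/-- The pairs of distinct points, each listed in increasing order. -/
def pointPairs : List (ℕ × ℕ) :=
  ((List.range' 1 7).product (List.range' 1 7)).filter (fun x => x.1 < x.2)

theorem mem_pts_of_mem_pointPairs :
    ∀ x ∈ pointPairs, x.1 ∈ pts ∧ x.2 ∈ pts ∧ x.1 ≠ x.2 := by
  decide +kernel

theorem isFano_of_mem_completions :
    ∀ F ∈ completions pointPairs ∅, IsFano F ∧ ∀ l ∈ F, Defective l := by
  decide +kernel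

theorem card_completions : (completions pointPairs ∅).card = 6 := by
  decide +kernel

theorem filter_defective_fanos :
    fanos.filter (fun F => ∀ l ∈ F, Defective l) = completions pointPairs ∅ := by
  ext F
  simp only [fanos, Finset.mem_filter, Finset.mem_powersetCard]
  constructor
  · rintro ⟨⟨-, hF⟩, hdef⟩
    obtain ⟨B, hB, hBF⟩ :=
      hF.exists_completion_subset hdef pointPairs mem_pts_of_mem_pointPairs ∅ (by simp)
    have hcard : F.card ≤ B.card := by
      rw [hF.2.1, (isFano_of_mem_completions B hB).1.2.1]
    exact Finset.eq_of_subset_of_card_le hBF hcard ▸ hB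
  · intro h
    obtain ⟨hF, hdef⟩ := isFano_of_mem_completions F h
    exact ⟨⟨⟨hF.1, hF.2.1⟩, hF⟩, hdef⟩

theorem all_defective_count :
    (fanos.filter (fun F => ∀ l ∈ F, Defective l)).card = 6 := by
  rw [filter_defective_fanos, card_completions]
end
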